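/- arXiv:2106.00730 — 4 statements merged into one kernel-verified Lean document; each statement's English description precedes it below -/
import Mathlib

section
/- Let L ≥ 1, let f : Fin L → ℝ satisfy f ℓ > 0 for every ℓ and ∑_ℓ f ℓ = 1, and let β : Fin L → ℝ be sorted, i.e. β i · f j ≥ β j · f i whenever i ≤ j. Let t be the least index with ∑_{ℓ ≤ t} f ℓ ≥ 1/2, and define the greedy vector α* by α* ℓ = 1 for ℓ < t, α* t = (1/2 − ∑_{ℓ < t} f ℓ)/(f t), and α* ℓ = 0 for ℓ > t. Then for every α : Fin L → ℝ with 0 ≤ α ℓ ≤ 1 for all ℓ and ∑_ℓ α ℓ · f ℓ = 1/2, one has ∑_ℓ α ℓ · β ℓ ≤ ∑_ℓ α* ℓ · β ℓ; that is, the greedy vector is an optimal solution of the standard-form LP. -/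
open Finset

/-- Lemma 1 of the paper (standard form): the greedy fractional-threshold vector
is an optimal solution of the standard-form LP
  max ∑ ℓ, α ℓ * β ℓ  s.t.  0 ≤ α ℓ ≤ 1, ∑ ℓ, α ℓ * f ℓ = 1/2,
when the coefficients are sorted (β ℓ / f ℓ nonincreasing). -/
theorem greedy_optimal_standard_form
    (L : ℕ) (hL : 1 ≤ L) (f β : Fin L → ℝ)
    (hfpos : ∀ ℓ, 0 < f ℓ) (hfsum : ∑ ℓ, f ℓ = 1)
    (hsorted : ∀ i j : Fin L, i ≤ j → β j * f i ≤ β i * f j)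
    (t : Fin L)
    (ht : 1/2 ≤ ∑ ℓ ∈ Finset.Iic t, f ℓ)
    (ht_least : ∀ s : Fin L, s < t → ∑ ℓ ∈ Finset.Iic s, f ℓ < 1/2)
    (αstar : Fin L → ℝ)
    (hαstar : αstar = fun ℓ =>
      if ℓ < t then 1
      else if ℓ = t then (1/2 - ∑ ℓ' ∈ Finset.Iio t, f ℓ') / f t
      else 0) :
    ∀ α : Fin L → ℝ, (∀ ℓ, 0 ≤ α ℓ) → (∀ ℓ, α ℓ ≤ 1) →
      (∑ ℓ, α ℓ * f ℓ = 1/2) →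
      ∑ ℓ, α ℓ * β ℓ ≤ ∑ ℓ, αstar ℓ * β ℓ := by
  intro α hα0 hα1 hαsum
  have hft := hfpos t
  have hsum : ∑ ℓ, αstar ℓ * f ℓ = 1/2 := by
    have hsplit : ∀ ℓ, αstar ℓ * f ℓ = (if ℓ < t then f ℓ else 0) +
        (if ℓ = t then 1/2 - ∑ ℓ' ∈ Finset.Iio t, f ℓ' else 0) := by
      intro ℓ
      rcases lt_trichotomy ℓ t with h | h | h
      · simp [hαstar, h, h.ne]
      · subst h
        simp [hαstar, hft.ne']
      · simp [hαstar, h.not_gt, h.ne']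
    have hIio : Finset.univ.filter (· < t) = Finset.Iio t := by
      ext ℓ
      simp
    simp_rw [hsplit]
    rw [Finset.sum_add_distrib, ← Finset.sum_filter, hIio, Finset.sum_ite_eq' Finset.univ t]
    simp
  have hterm : ∀ ℓ, 0 ≤ (αstar ℓ - α ℓ) * (β ℓ - β t / f t * f ℓ) := by
    intro ℓ
    rcases lt_trichotomy ℓ t with h | h | h
    · have hβ : β t / f t * f ℓ ≤ β ℓ := by
        rw [div_mul_eq_mul_div, div_le_iff₀ hft]
        exact hsorted ℓ t h.le
      have hstar : αstar ℓ = 1 := by simp [hαstar, h]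
      rw [hstar]
      exact mul_nonneg (sub_nonneg.2 (hα1 ℓ)) (sub_nonneg.2 hβ)
    · subst h
      simp [hft.ne']
    · have hβ : β ℓ ≤ β t / f t * f ℓ := by
        rw [div_mul_eq_mul_div, le_div_iff₀ hft]
        exact hsorted t ℓ h.le
      have hstar : αstar ℓ = 0 := by simp [hαstar, h.not_gt, h.ne']
      rw [hstar]
      exact mul_nonneg_of_nonpos_of_nonpos (by linarith [hα0 ℓ]) (sub_nonpos.2 hβ)
  have hexpand : ∑ ℓ, (αstar ℓ - α ℓ) * (β ℓ - β t / f t * f ℓ) =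
      (∑ ℓ, αstar ℓ * β ℓ - ∑ ℓ, α ℓ * β ℓ) -
        β t / f t * (∑ ℓ, αstar ℓ * f ℓ - ∑ ℓ, α ℓ * f ℓ) := by
    rw [← Finset.sum_sub_distrib, ← Finset.sum_sub_distrib, Finset.mul_sum,
      ← Finset.sum_sub_distrib]
    exact Finset.sum_congr rfl fun ℓ _ => by ring
  have hnonneg := Finset.sum_nonneg fun ℓ (_ : ℓ ∈ Finset.univ) => hterm ℓ
  rw [hexpand, hsum, hαsum, sub_self, mul_zero, sub_zero] at hnonneg
  exact sub_nonneg.1 hnonneg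
end

section
/- Let L ≥ 1, let f : Fin L → ℝ satisfy f ℓ > 0 for every ℓ and ∑_ℓ f ℓ = 1, and let β : Fin L → ℝ be sorted, i.e. β i · f j ≥ β j · f i whenever i ≤ j. Let t be the least index with ∑_{ℓ ≤ t} f ℓ ≥ 1/2, and define α* by α* ℓ = 1 for ℓ < t, α* t = (1 − 2·∑_{ℓ < t} f ℓ − f t)/(f t), and α* ℓ = −1 for ℓ > t. Then α* t ∈ [−1, 1], ∑_ℓ α* ℓ · f ℓ = 0, and for every α : Fin L → ℝ with −1 ≤ α ℓ ≤ 1 for all ℓ and ∑_ℓ α ℓ · f ℓ = 0, one has ∑_ℓ α ℓ · β ℓ ≤ ∑_ℓ α* ℓ · β ℓ. -/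
open Finset

/-- If every partial sum up to some `s < t` is at most `c`, so is the sum over all indices
below `t`. -/
theorem sum_Iio_le_of_forall_sum_Iic_le {L : ℕ} {f : Fin L → ℝ} (hf : ∀ ℓ, 0 ≤ f ℓ)
    {c : ℝ} (hc : 0 ≤ c) {t : Fin L} (h : ∀ s < t, ∑ ℓ ∈ Finset.Iic s, f ℓ ≤ c) :
    ∑ ℓ ∈ Finset.Iio t, f ℓ ≤ c := by
  rcases (Finset.Iio t).eq_empty_or_nonempty with he | hne
  · simpa [he] using hc
  · refine le_trans (Finset.sum_le_sum_of_subset_of_nonneg (fun x hx => ?_) fun i _ _ => hf i)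
      (h ((Finset.Iio t).max' hne) (Finset.mem_Iio.1 (Finset.max'_mem _ hne)))
    exact Finset.mem_Iic.2 (Finset.le_max' _ x hx)

/-- Exchange argument: `a` beats `b` for the objective `β` under the same budget `f`, if `a - b`
has the sign of `β ℓ / f ℓ - β t / f t` at every `ℓ`. -/
theorem sum_mul_le_of_exchange {ι : Type*} [Fintype ι] {f β a b : ι → ℝ} {t : ι} (ht : 0 < f t)
    (hab : ∑ ℓ, b ℓ * f ℓ = ∑ ℓ, a ℓ * f ℓ)
    (h : ∀ ℓ, 0 ≤ (a ℓ - b ℓ) * (β ℓ * f t - β t * f ℓ)) :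
    ∑ ℓ, b ℓ * β ℓ ≤ ∑ ℓ, a ℓ * β ℓ := by
  have key : ∑ ℓ, (a ℓ - b ℓ) * (β ℓ * f t - β t * f ℓ)
      = f t * (∑ ℓ, a ℓ * β ℓ - ∑ ℓ, b ℓ * β ℓ)
        - β t * (∑ ℓ, a ℓ * f ℓ - ∑ ℓ, b ℓ * f ℓ) := by
    simp only [← Finset.sum_sub_distrib, Finset.mul_sum]
    exact Finset.sum_congr rfl fun ℓ _ => by ring
  have hnonneg := Finset.sum_nonneg fun ℓ (_ : ℓ ∈ Finset.univ) => h ℓ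
  rw [key, hab, sub_self, mul_zero, sub_zero] at hnonneg
  exact sub_nonneg.1 (nonneg_of_mul_nonneg_right hnonneg ht)

/-- Lemma 1 of the paper (symmetric form): sorting labels by β ℓ / f ℓ,
assigning +1 from the top until the accumulated weight exceeds 1/2, assigning
the threshold label fractionally, and −1 thereafter, yields a feasible and
optimal solution of the LP
  max ∑ ℓ, α ℓ * β ℓ  s.t.  −1 ≤ α ℓ ≤ 1, ∑ ℓ, α ℓ * f ℓ = 0. -/
theorem greedy_optimal_symmetric_form
    (L : ℕ) (hL : 1 ≤ L) (f β : Fin L → ℝ)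
    (hfpos : ∀ ℓ, 0 < f ℓ) (hfsum : ∑ ℓ, f ℓ = 1)
    (hsorted : ∀ i j : Fin L, i ≤ j → β j * f i ≤ β i * f j)
    (t : Fin L)
    (ht : 1/2 ≤ ∑ ℓ ∈ Finset.Iic t, f ℓ)
    (ht_least : ∀ s : Fin L, s < t → ∑ ℓ ∈ Finset.Iic s, f ℓ < 1/2)
    (αstar : Fin L → ℝ)
    (hαstar : αstar = fun ℓ =>
      if ℓ < t then 1
      else if ℓ = t then (1 - 2 * ∑ ℓ' ∈ Finset.Iio t, f ℓ' - f t) / f t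
      else -1) :
    (-1 ≤ αstar t ∧ αstar t ≤ 1) ∧
    (∑ ℓ, αstar ℓ * f ℓ = 0) ∧
    (∀ α : Fin L → ℝ, (∀ ℓ, -1 ≤ α ℓ) → (∀ ℓ, α ℓ ≤ 1) →
      (∑ ℓ, α ℓ * f ℓ = 0) →
      ∑ ℓ, α ℓ * β ℓ ≤ ∑ ℓ, αstar ℓ * β ℓ) := by
  have hS : ∑ ℓ ∈ Finset.Iio t, f ℓ ≤ 1 / 2 :=
    sum_Iio_le_of_forall_sum_Iic_le (fun ℓ => (hfpos ℓ).le) (by norm_num)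
      fun s hs => (ht_least s hs).le
  have hsplit : ∑ ℓ ∈ Finset.Iic t, f ℓ = f t + ∑ ℓ ∈ Finset.Iio t, f ℓ := by
    rw [← Finset.Iio_insert, Finset.sum_insert (by simp)]
  have hlt : ∀ ℓ, ℓ < t → αstar ℓ = 1 := fun ℓ h => by simp [hαstar, h]
  have hgt : ∀ ℓ, t < ℓ → αstar ℓ = -1 := fun ℓ h => by
    simp [hαstar, h.not_gt, h.ne']
  have hat : αstar t = (1 - 2 * ∑ ℓ ∈ Finset.Iio t, f ℓ - f t) / f t := by simp [hαstar]
  have hzero : ∑ ℓ, αstar ℓ * f ℓ = 0 := by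
    have hterm : ∀ ℓ, αstar ℓ * f ℓ = 2 * (if ℓ < t then f ℓ else 0)
        + (if ℓ = t then 1 - 2 * ∑ ℓ' ∈ Finset.Iio t, f ℓ' else 0) - f ℓ := by
      intro ℓ
      rcases lt_trichotomy ℓ t with h | rfl | h
      · rw [hlt ℓ h, if_pos h, if_neg h.ne]
        ring
      · rw [hat, div_mul_cancel₀ _ (hfpos ℓ).ne', if_neg (lt_irrefl ℓ), if_pos rfl]
        ring
      · rw [hgt ℓ h, if_neg h.not_gt, if_neg h.ne']
        ring
    have hfilter : Finset.univ.filter (· < t) = Finset.Iio t := by ext; simp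
    simp only [hterm, Finset.sum_sub_distrib, Finset.sum_add_distrib, ← Finset.mul_sum,
      ← Finset.sum_filter (· < t), hfilter, Finset.sum_ite_eq', Finset.mem_univ, if_true, hfsum]
    ring
  refine ⟨⟨?_, ?_⟩, hzero, fun α hα₁ hα₂ hα₀ => ?_⟩
  · rw [hat, le_div_iff₀ (hfpos t)]
    linarith
  · rw [hat, div_le_iff₀ (hfpos t)]
    linarith
  · refine sum_mul_le_of_exchange (hfpos t) (hα₀.trans hzero.symm) fun ℓ => ?_
    rcases lt_trichotomy ℓ t with h | rfl | h
    · rw [hlt ℓ h]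
      exact mul_nonneg (sub_nonneg.2 (hα₂ ℓ)) (sub_nonneg.2 (hsorted ℓ t h.le))
    · simp
    · rw [hgt ℓ h]
      exact mul_nonneg_of_nonpos_of_nonpos (sub_nonpos.2 (hα₁ ℓ))
        (sub_nonpos.2 (hsorted t ℓ h.le))
end

section
/- Let L ≥ 1, let f : Fin L → ℝ satisfy f ℓ > 0 for every ℓ, and let β : Fin L → ℝ be sorted, i.e. β i · f j ≥ β j · f i whenever i ≤ j. Fix any index t and define μ* = β t / f t and y* : Fin L → ℝ by y* ℓ = β ℓ − f ℓ · (β t / f t) for ℓ < t and y* ℓ = 0 for ℓ ≥ t. Then y* ℓ ≥ 0 for every ℓ, and y* ℓ + f ℓ · μ* ≥ β ℓ for every ℓ; that is, (y*, μ*) is a dual feasible certificate for the standard-form LP. -/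
open Finset

/-- Dual feasibility of the certificate constructed in the proof of Lemma 1:
with μ* = β t / f t and y* ℓ = β ℓ − f ℓ * (β t / f t) for ℓ < t, y* ℓ = 0
for ℓ ≥ t, one has y* ℓ ≥ 0 and y* ℓ + f ℓ * μ* ≥ β ℓ for every ℓ. -/
theorem dual_certificate_feasible
    (L : ℕ) (hL : 1 ≤ L) (f β : Fin L → ℝ)
    (hfpos : ∀ ℓ, 0 < f ℓ)
    (hsorted : ∀ i j : Fin L, i ≤ j → β j * f i ≤ β i * f j)
    (t : Fin L)
    (μstar : ℝ) (hμstar : μstar = β t / f t)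
    (ystar : Fin L → ℝ)
    (hystar : ystar = fun ℓ => if ℓ < t then β ℓ - f ℓ * (β t / f t) else 0) :
    (∀ ℓ, 0 ≤ ystar ℓ) ∧ (∀ ℓ, β ℓ ≤ ystar ℓ + f ℓ * μstar) := by
  subst hμstar hystar
  refine ⟨fun ℓ => ?_, fun ℓ => ?_⟩
  · dsimp only
    split_ifs with h
    · rw [sub_nonneg, ← mul_div_assoc, div_le_iff₀ (hfpos t), mul_comm (f ℓ)]
      exact hsorted ℓ t h.le
    · exact le_rfl
  · dsimp only
    split_ifs with h
    · rw [sub_add_cancel]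
    · rw [zero_add, ← mul_div_assoc, le_div_iff₀ (hfpos t), mul_comm (f ℓ)]
      exact hsorted t ℓ (not_lt.mp h)
end

section
/- Let L ≥ 1 and let f : Fin L → ℝ satisfy f ℓ > 0 for every ℓ, ∑_ℓ f ℓ = 1, and f i ≥ f j whenever i ≤ j (f is nonincreasing). Let t be the least index with ∑_{ℓ ≤ t} f ℓ ≥ 1/2, and define α* by α* ℓ = 1 for ℓ < t, α* t = (1 − 2·∑_{ℓ < t} f ℓ − f t)/(f t), and α* ℓ = −1 for ℓ > t. Then for every α : Fin L → ℝ with −1 ≤ α ℓ ≤ 1 for all ℓ and ∑_ℓ α ℓ · f ℓ = 0, one has ∑_ℓ α ℓ · (f ℓ)² ≤ ∑_ℓ α* ℓ · (f ℓ)². -/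
open Finset

/-- The Fano-coding LP (equation (2) of the paper): for a nonincreasing
frequency vector f, the greedy fractional-threshold assignment maximizes
∑ ℓ, α ℓ * (f ℓ)² over α ∈ [−1,1]^L with ∑ ℓ, α ℓ * f ℓ = 0. -/
theorem fano_lp_greedy_optimal
    (L : ℕ) (hL : 1 ≤ L) (f : Fin L → ℝ)
    (hfpos : ∀ ℓ, 0 < f ℓ) (hfsum : ∑ ℓ, f ℓ = 1)
    (hfmono : ∀ i j : Fin L, i ≤ j → f j ≤ f i)
    (t : Fin L)
    (ht : 1/2 ≤ ∑ ℓ ∈ Finset.Iic t, f ℓ)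
    (ht_least : ∀ s : Fin L, s < t → ∑ ℓ ∈ Finset.Iic s, f ℓ < 1/2)
    (αstar : Fin L → ℝ)
    (hαstar : αstar = fun ℓ =>
      if ℓ < t then 1
      else if ℓ = t then (1 - 2 * ∑ ℓ' ∈ Finset.Iio t, f ℓ' - f t) / f t
      else -1) :
    ∀ α : Fin L → ℝ, (∀ ℓ, -1 ≤ α ℓ) → (∀ ℓ, α ℓ ≤ 1) →
      (∑ ℓ, α ℓ * f ℓ = 0) →
      ∑ ℓ, α ℓ * (f ℓ) ^ 2 ≤ ∑ ℓ, αstar ℓ * (f ℓ) ^ 2 := by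
  intro α hlo hhi hα
  have hstar : ∑ ℓ, αstar ℓ * f ℓ = 0 := by
    have hsplit : ∀ ℓ, αstar ℓ * f ℓ = (if ℓ < t then 2 * f ℓ else 0)
        + (if ℓ = t then 1 - 2 * ∑ ℓ' ∈ Finset.Iio t, f ℓ' else 0) - f ℓ := by
      intro ℓ
      subst hαstar
      rcases lt_trichotomy ℓ t with h | rfl | h
      · simp only [h, h.ne, if_true, if_false]
        ring
      · simp only [lt_irrefl, if_true, if_false, div_mul_cancel₀ _ (hfpos ℓ).ne']
        ring
      · simp only [h.not_gt, h.ne', if_false]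
        ring
    have hIio : (Finset.univ.filter fun ℓ : Fin L => ℓ < t) = Finset.Iio t := by
      ext ℓ
      simp
    rw [Finset.sum_congr rfl fun ℓ _ => hsplit ℓ, Finset.sum_sub_distrib,
      Finset.sum_add_distrib, ← Finset.sum_filter, hIio, ← Finset.mul_sum, hfsum,
      Finset.sum_ite_eq' Finset.univ t, if_pos (Finset.mem_univ t)]
    ring
  have hterm : ∀ ℓ, 0 ≤ (αstar ℓ - α ℓ) * (f ℓ * (f ℓ - f t)) := by
    intro ℓ
    subst hαstar
    rcases lt_trichotomy ℓ t with h | rfl | h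
    · simp only [h, if_true]
      exact mul_nonneg (sub_nonneg.2 (hhi ℓ))
        (mul_nonneg (hfpos ℓ).le (sub_nonneg.2 (hfmono ℓ t h.le)))
    · simp
    · simp only [h.not_gt, h.ne', if_false]
      exact mul_nonneg_of_nonpos_of_nonpos (sub_nonpos.2 (hlo ℓ))
        (mul_nonpos_of_nonneg_of_nonpos (hfpos ℓ).le (sub_nonpos.2 (hfmono t ℓ h.le)))
  have hexpand : ∑ ℓ, (αstar ℓ - α ℓ) * (f ℓ * (f ℓ - f t))
      = ∑ ℓ, αstar ℓ * f ℓ ^ 2 - ∑ ℓ, α ℓ * f ℓ ^ 2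
        - f t * (∑ ℓ, αstar ℓ * f ℓ - ∑ ℓ, α ℓ * f ℓ) := by
    simp only [← Finset.sum_sub_distrib, Finset.mul_sum]
    exact Finset.sum_congr rfl fun ℓ _ => by ring
  have hnonneg := Finset.sum_nonneg fun ℓ (_ : ℓ ∈ Finset.univ) => hterm ℓ
  rw [hexpand, hstar, hα] at hnonneg
  linarith
end
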